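/- arXiv:2201.09987 — 4 statements merged into one kernel-verified Lean document; each statement's English description precedes it below -/
import Mathlib

section
/- For every n ≥ 1 and every n-cochain φ on A, the anticommutation relation b(Bφ) + B(bφ) = 0 holds, i.e. for all a₀,…,a_n ∈ A one has (b(Bφ))(a₀,…,a_n) + (B(bφ))(a₀,…,a_n) = 0. -/
/-!
The anticommutation relation `bB + Bb = 0` between the Hochschild coboundary `b`
and the Connes operator `B = N ∘ B₀` on cochains of a unital associative ℂ-algebra.
-/

/-- The Hochschild coboundary of an `n`-cochain `φ`, an `(n+1)`-cochain. -/
noncomputable def hochschildb {A : Type*} [Ring A] (n : ℕ) (φ : (Fin (n + 1) → A) → ℂ) :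
    (Fin (n + 2) → A) → ℂ := fun a =>
  (∑ i : Fin (n + 1), (-1 : ℂ) ^ (i : ℕ) *
      φ (fun j => if (j : ℕ) < (i : ℕ) then a j.castSucc
        else if (j : ℕ) = (i : ℕ) then a j.castSucc * a j.succ
        else a j.succ)) +
    (-1 : ℂ) ^ (n + 1) *
      φ (fun j => if (j : ℕ) = 0 then a (Fin.last (n + 1)) * a 0 else a j.castSucc)

/-- The operator `B₀ : C^{n+1}(A) → C^n(A)`,
`(B₀φ)(a₀,…,a_n) = φ(1,a₀,…,a_n) − (−1)^{n+1} φ(a₀,…,a_n,1)`. -/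
noncomputable def connesB0 {A : Type*} [Ring A] (n : ℕ)
    (φ : (Fin (n + 2) → A) → ℂ) : (Fin (n + 1) → A) → ℂ := fun a =>
  φ (Fin.cons 1 a) - (-1 : ℂ) ^ (n + 1) * φ (Fin.snoc a 1)

/-- The cyclic antisymmetrizer `N : C^n(A) → C^n(A)`,
`(Nψ)(a₀,…,a_n) = Σ_{j=0}^{n} (−1)^{nj} ψ(a_j,…,a_n,a₀,…,a_{j−1})`. -/
noncomputable def cyclicN {A : Type*} [Ring A] (n : ℕ)
    (ψ : (Fin (n + 1) → A) → ℂ) : (Fin (n + 1) → A) → ℂ := fun a =>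
  ∑ j : Fin (n + 1), (-1 : ℂ) ^ (n * (j : ℕ)) * ψ (fun k => a (j + k))

/-- The Connes operator `B = N ∘ B₀ : C^{n+1}(A) → C^n(A)`. -/
noncomputable def connesB {A : Type*} [Ring A] (n : ℕ)
    (φ : (Fin (n + 2) → A) → ℂ) : (Fin (n + 1) → A) → ℂ :=
  cyclicN n (connesB0 n φ)

/-- The face map multiplying the neighbouring entries `a i` and `a (i + 1)`. -/
def mulFace {A : Type*} [Ring A] {n : ℕ} (i : Fin (n + 1)) (a : Fin (n + 2) → A) :
    Fin (n + 1) → A := fun j =>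
  if (j : ℕ) < (i : ℕ) then a j.castSucc
  else if (j : ℕ) = (i : ℕ) then a j.castSucc * a j.succ
  else a j.succ

/-- The face map multiplying the last entry with the first one. -/
def wrapFace {A : Type*} [Ring A] {n : ℕ} (a : Fin (n + 2) → A) : Fin (n + 1) → A := fun j =>
  if (j : ℕ) = 0 then a (Fin.last (n + 1)) * a 0 else a j.castSucc

/-- The truncated Hochschild coboundary `b'`, without the wrap-around term. -/
noncomputable def hochschildb' {A : Type*} [Ring A] (n : ℕ) (φ : (Fin (n + 1) → A) → ℂ) :
    (Fin (n + 2) → A) → ℂ := fun a =>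
  ∑ i : Fin (n + 1), (-1 : ℂ) ^ (i : ℕ) * φ (mulFace i a)

theorem hochschildb_eq {A : Type*} [Ring A] (n : ℕ) (φ : (Fin (n + 1) → A) → ℂ)
    (a : Fin (n + 2) → A) :
    hochschildb n φ a = hochschildb' n φ a + (-1 : ℂ) ^ (n + 1) * φ (wrapFace a) := rfl

theorem Fin.val_sub_eq_ite {n : ℕ} (x y : Fin (n + 1)) :
    (x - y).val = if y.val ≤ x.val then x.val - y.val else x.val + (n + 1) - y.val := by
  have hx := x.isLt
  have hy := y.isLt
  rw [Fin.val_sub]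
  split_ifs with h
  · rw [show n + 1 - y.val + x.val = (x.val - y.val) + (n + 1) by omega, Nat.add_mod_right,
      Nat.mod_eq_of_lt (by omega)]
  · rw [Nat.mod_eq_of_lt (by omega)]
    omega

theorem neg_one_pow_eq_of_even_add {x y : ℕ} (h : Even (x + y)) :
    (-1 : ℂ) ^ x = (-1) ^ y := by
  rw [neg_one_pow_eq_pow_mod_two, neg_one_pow_eq_pow_mod_two (n := y)]
  rw [Nat.even_iff] at h
  congr 1
  omega

theorem mulFace_rotate {A : Type*} [Ring A] {n : ℕ} (p q : Fin (n + 1)) (a : Fin (n + 2) → A) :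
    (fun k => mulFace p a (p - q + k)) =
      mulFace q (fun k => a (p.castSucc - q.castSucc + k)) := by
  funext k
  have hp := p.isLt
  have hq := q.isLt
  have hk := k.isLt
  have h₁ := Fin.val_sub_eq_ite p q
  have h₂ := Fin.val_add_eq_ite (p - q) k
  have h₃ := Fin.val_sub_eq_ite p.castSucc q.castSucc
  have h₄ := Fin.val_add_eq_ite (p.castSucc - q.castSucc) k.castSucc
  have h₅ := Fin.val_add_eq_ite (p.castSucc - q.castSucc) k.succ
  simp only [Fin.val_castSucc, Fin.val_succ] at h₃ h₄ h₅
  unfold mulFace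
  rcases lt_trichotomy k.val q.val with h | h | h
  · rw [if_pos h]
    by_cases hc : (p - q + k).val < p.val
    · rw [if_pos hc]
      congr 1
      ext
      simp only [Fin.val_castSucc]
      grind
    · rw [if_neg hc, if_neg (by grind)]
      congr 1
      ext
      simp only [Fin.val_succ]
      grind
  · rw [if_neg (by grind), if_pos (by grind), if_neg (by omega), if_pos h]
    congr 2 <;> ext <;> simp only [Fin.val_castSucc, Fin.val_succ] <;> grind
  · by_cases hc : (p - q + k).val < p.val
    · rw [if_pos hc, if_neg (by omega), if_neg (by omega)]
      congr 1
      ext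
      simp only [Fin.val_castSucc]
      grind
    · rw [if_neg hc, if_neg (by grind), if_neg (by omega), if_neg (by omega)]
      congr 1
      ext
      simp only [Fin.val_succ]
      grind

theorem wrapFace_rotate {A : Type*} [Ring A] {n : ℕ} (q : Fin (n + 1)) (a : Fin (n + 2) → A) :
    (fun k => wrapFace a (0 - q + k)) =
      mulFace q (fun k => a (Fin.last (n + 1) - q.castSucc + k)) := by
  funext k
  have hq := q.isLt
  have hk := k.isLt
  have h₁ := Fin.val_sub_eq_ite 0 q
  have h₂ := Fin.val_add_eq_ite (0 - q) k
  have h₃ := Fin.val_sub_eq_ite (Fin.last (n + 1)) q.castSucc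
  have h₄ := Fin.val_add_eq_ite (Fin.last (n + 1) - q.castSucc) k.castSucc
  have h₅ := Fin.val_add_eq_ite (Fin.last (n + 1) - q.castSucc) k.succ
  simp only [Fin.val_castSucc, Fin.val_succ, Fin.val_last, Fin.val_zero] at h₁ h₃ h₄ h₅
  unfold mulFace wrapFace
  rcases lt_trichotomy k.val q.val with h | h | h
  · rw [if_pos h, if_neg (by grind)]
    congr 1
    ext
    simp only [Fin.val_castSucc]
    grind
  · rw [if_pos (by grind), if_neg (by omega), if_pos h]
    congr 2 <;> ext <;> simp only [Fin.val_last, Fin.val_zero] <;> grind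
  · rw [if_neg (by grind), if_neg (by omega), if_neg (by omega)]
    congr 1
    ext
    simp only [Fin.val_castSucc]
    grind

theorem neg_one_pow_mulFace_rotate {n : ℕ} (p q : Fin (n + 1)) :
    (-1 : ℂ) ^ (p : ℕ) * (-1) ^ (n * ((p - q : Fin (n + 1)) : ℕ)) =
      (-1) ^ ((n + 1) * ((p.castSucc - q.castSucc : Fin (n + 2)) : ℕ)) * (-1) ^ (q : ℕ) := by
  have hq := q.isLt
  rw [← pow_add, ← pow_add, Fin.val_sub_eq_ite, Fin.val_sub_eq_ite]
  simp only [Fin.val_castSucc]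
  apply neg_one_pow_eq_of_even_add
  split_ifs with h
  · obtain ⟨d, hd⟩ := Nat.exists_eq_add_of_le h
    rw [hd, Nat.add_sub_cancel_left]
    exact ⟨q + d + n * d, by ring⟩
  · obtain ⟨d, hd⟩ := Nat.exists_eq_add_of_le (show q.val ≤ p.val + (n + 1) by omega)
    rw [show p.val + (n + 1 + 1) - q.val = d + 1 by omega,
      show p.val + (n + 1) - q.val = d by omega]
    exact ⟨q + n * d + d, by linear_combination hd⟩

theorem neg_one_pow_wrapFace_rotate {n : ℕ} (q : Fin (n + 1)) :
    (-1 : ℂ) ^ (n + 1) * (-1) ^ (n * ((0 - q : Fin (n + 1)) : ℕ)) =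
      (-1) ^ ((n + 1) * ((Fin.last (n + 1) - q.castSucc : Fin (n + 2)) : ℕ)) *
        (-1) ^ (q : ℕ) := by
  have hq := q.isLt
  have h₀ : ((0 - q : Fin (n + 1)) : ℕ) = if q.val ≤ 0 then 0 - q.val else 0 + (n + 1) - q.val :=
    Fin.val_sub_eq_ite 0 q
  have h₁ : ((Fin.last (n + 1) - q.castSucc : Fin (n + 2)) : ℕ) = n + 1 - q.val := by
    rw [Fin.val_sub_eq_ite, if_pos (Fin.le_def.mp (Fin.le_last _))]
    rfl
  rw [← pow_add, ← pow_add, h₁]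
  apply neg_one_pow_eq_of_even_add
  by_cases h : q.val ≤ 0
  · rw [h₀, if_pos h, show q.val = 0 by omega]
    convert Nat.even_mul_succ_self (n + 1) using 1
    simp only [Nat.sub_zero]
    ring
  · obtain ⟨d, hd⟩ := Nat.exists_eq_add_of_le (show q.val ≤ n + 1 by omega)
    rw [h₀, if_neg h, show 0 + (n + 1) - q.val = d by omega, show n + 1 - q.val = d by omega]
    exact ⟨q + n * d + d, by linear_combination hd⟩

theorem hochschildb_cyclicN {A : Type*} [Ring A] (n : ℕ) (ψ : (Fin (n + 1) → A) → ℂ)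
    (a : Fin (n + 2) → A) :
    hochschildb n (cyclicN n ψ) a = cyclicN (n + 1) (hochschildb' n ψ) a := by
  have hN : cyclicN (n + 1) (hochschildb' n ψ) a =
      ∑ p : Fin (n + 2), ∑ q : Fin (n + 1),
        (-1 : ℂ) ^ ((n + 1) * ((p - q.castSucc : Fin (n + 2)) : ℕ)) * (-1) ^ (q : ℕ) *
          ψ (mulFace q (fun k => a (p - q.castSucc + k))) := by
    simp only [cyclicN, hochschildb', Finset.mul_sum]
    rw [Finset.sum_comm]
    conv_rhs => rw [Finset.sum_comm]
    refine Finset.sum_congr rfl fun q _ => ?_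
    rw [← Equiv.sum_comp (Equiv.subRight q.castSucc)]
    simp only [Equiv.subRight_apply, mul_assoc]
  rw [hN, Fin.sum_univ_castSucc, hochschildb_eq]
  congr 1
  · refine Finset.sum_congr rfl fun p _ => ?_
    rw [cyclicN, Finset.mul_sum, ← Equiv.sum_comp (Equiv.subLeft p)]
    refine Finset.sum_congr rfl fun q _ => ?_
    rw [Equiv.subLeft_apply, ← mul_assoc, neg_one_pow_mulFace_rotate, mulFace_rotate]
  · rw [cyclicN, Finset.mul_sum, ← Equiv.sum_comp (Equiv.subLeft 0)]
    refine Finset.sum_congr rfl fun q _ => ?_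
    rw [Equiv.subLeft_apply, ← mul_assoc, neg_one_pow_wrapFace_rotate, wrapFace_rotate]

theorem mulFace_zero_cons_one {A : Type*} [Ring A] {n : ℕ} (a : Fin (n + 1) → A) :
    mulFace 0 (Fin.cons 1 a : Fin (n + 2) → A) = a := by
  funext j
  refine Fin.cases ?_ (fun j => ?_) j <;> simp [mulFace]

theorem mulFace_succ_cons {A : Type*} [Ring A] {n : ℕ} (i : Fin (n + 1)) (x : A)
    (a : Fin (n + 2) → A) :
    mulFace i.succ (Fin.cons x a : Fin (n + 3) → A) = Fin.cons x (mulFace i a) := by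
  funext j
  refine Fin.cases ?_ (fun j => ?_) j <;> simp [mulFace]

theorem wrapFace_cons_one {A : Type*} [Ring A] {n : ℕ} (a : Fin (n + 1) → A) :
    wrapFace (Fin.cons 1 a : Fin (n + 2) → A) = fun k => a (k - 1) := by
  funext j
  refine Fin.cases ?_ (fun j => ?_) j
  · rw [← Fin.last_add_one, add_sub_cancel_right]
    simp [wrapFace, ← Fin.succ_last]
  · rw [← Fin.coeSucc_eq_succ, add_sub_cancel_right, Fin.coeSucc_eq_succ]
    simp [wrapFace]

theorem mulFace_last_snoc_one {A : Type*} [Ring A] {n : ℕ} (a : Fin (n + 1) → A) :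
    mulFace (Fin.last n) (Fin.snoc a 1 : Fin (n + 2) → A) = a := by
  funext j
  refine Fin.lastCases ?_ (fun j => ?_) j <;> simp [mulFace]

theorem mulFace_castSucc_snoc {A : Type*} [Ring A] {n : ℕ} (i : Fin (n + 1)) (x : A)
    (a : Fin (n + 2) → A) :
    mulFace i.castSucc (Fin.snoc a x : Fin (n + 3) → A) = Fin.snoc (mulFace i a) x := by
  funext j
  refine Fin.lastCases ?_ (fun j => ?_) j
  · have hi : ¬ n + 1 < (i : ℕ) ∧ n + 1 ≠ (i : ℕ) := by omega
    simp [mulFace, hi]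
  · simp [mulFace, Fin.succ_castSucc, -Fin.castSucc_succ]

theorem wrapFace_snoc_one {A : Type*} [Ring A] {n : ℕ} (a : Fin (n + 1) → A) :
    wrapFace (Fin.snoc a 1 : Fin (n + 2) → A) = a := by
  funext j
  refine Fin.cases ?_ (fun j => ?_) j <;> simp [wrapFace, -Fin.castSucc_succ]

theorem connesB0_hochschildb_add {A : Type*} [Ring A] (n : ℕ) (φ : (Fin (n + 2) → A) → ℂ)
    (a : Fin (n + 2) → A) :
    hochschildb' n (connesB0 n φ) a + connesB0 (n + 1) (hochschildb (n + 1) φ) a =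
      φ a - (-1) ^ (n + 1) * φ (fun k => a (k - 1)) := by
  have h₁ : hochschildb' (n + 1) φ (Fin.cons 1 a) =
      φ a - hochschildb' n (fun c => φ (Fin.cons 1 c)) a := by
    simp only [hochschildb', Fin.sum_univ_succ (n := n + 1), mulFace_zero_cons_one,
      mulFace_succ_cons, Fin.val_succ, pow_succ, Fin.val_zero]
    simp [sub_eq_add_neg]
  have h₂ : hochschildb' (n + 1) φ (Fin.snoc a 1) =
      hochschildb' n (fun c => φ (Fin.snoc c 1)) a + (-1) ^ (n + 1) * φ a := by
    simp only [hochschildb', Fin.sum_univ_castSucc (n := n + 1), mulFace_last_snoc_one,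
      mulFace_castSucc_snoc, Fin.val_castSucc, Fin.val_last]
  have h₃ : hochschildb' n (connesB0 n φ) a =
      hochschildb' n (fun c => φ (Fin.cons 1 c)) a -
        (-1) ^ (n + 1) * hochschildb' n (fun c => φ (Fin.snoc c 1)) a := by
    simp only [hochschildb', connesB0, Finset.mul_sum, ← Finset.sum_sub_distrib]
    exact Finset.sum_congr rfl fun i _ => by ring
  rw [h₃, connesB0, hochschildb_eq, hochschildb_eq, h₁, h₂, wrapFace_cons_one, wrapFace_snoc_one]
  ring

theorem cyclicN_rotate {A : Type*} [Ring A] (n : ℕ) (φ : (Fin (n + 1) → A) → ℂ)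
    (a : Fin (n + 1) → A) :
    cyclicN n (fun c => φ c - (-1) ^ n * φ (fun k => c (k - 1))) a = 0 := by
  have hsign (j : Fin (n + 1)) :
      (-1 : ℂ) ^ (n * ((j + 1 : Fin (n + 1)) : ℕ)) * (-1) ^ n = (-1) ^ (n * (j : ℕ)) := by
    rw [← pow_add]
    apply neg_one_pow_eq_of_even_add
    rw [Fin.val_add_one]
    split_ifs with h
    · subst h
      simpa [mul_add, add_comm] using Nat.even_mul_succ_self n
    · exact ⟨n * (j + 1), by ring⟩
  simp only [cyclicN, mul_sub, Finset.sum_sub_distrib]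
  rw [sub_eq_zero]
  conv_rhs => rw [← Equiv.sum_comp (Equiv.addRight 1)]
  refine Finset.sum_congr rfl fun j _ => ?_
  rw [Equiv.coe_addRight, ← mul_assoc, hsign]
  simp only [add_assoc, add_sub_cancel]

/-- For every `n ≥ 1` and every `n`-cochain `φ` on a unital associative ℂ-algebra `A`
(here the degree is `n = m + 1` with `m ≥ 0`), the anticommutation relation
`b(Bφ) + B(bφ) = 0` holds: for all `a₀,…,a_n ∈ A`,
`(b(Bφ))(a₀,…,a_n) + (B(bφ))(a₀,…,a_n) = 0`. -/
theorem hochschild_b_connes_B_anticommute {A : Type*} [Ring A] [Algebra ℂ A]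
    (m : ℕ) (φ : (Fin (m + 2) → A) → ℂ) (a : Fin (m + 2) → A) :
    hochschildb m (connesB m φ) a + connesB (m + 1) (hochschildb (m + 1) φ) a = 0 := by
  rw [connesB, hochschildb_cyclicN, connesB]
  have hN := cyclicN_rotate (m + 1) φ a
  simp only [← connesB0_hochschildb_add] at hN
  rw [← hN]
  simp only [cyclicN, mul_add, Finset.sum_add_distrib]
end

section
/- The 3-cochain φ₃ on A is a Hochschild cocycle: for all ã₀, ã₁, ã₂, ã₃, ã₄ ∈ A, φ₃(ã₀ã₁, ã₂, ã₃, ã₄) − φ₃(ã₀, ã₁ã₂, ã₃, ã₄) + φ₃(ã₀, ã₁, ã₂ã₃, ã₄) − φ₃(ã₀, ã₁, ã₂, ã₃ã₄) + φ₃(ã₄ã₀, ã₁, ã₂, ã₃) = 0, i.e. bφ₃ = 0. -/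
open MeasureTheory

/-- The partial derivative in the `i`-th coordinate of `ℝ³` of a function `f : ℝ³ → ℂ`. -/
noncomputable def pd (i : Fin 3) (f : (Fin 3 → ℝ) → ℂ) (x : Fin 3 → ℝ) : ℂ :=
  fderiv ℝ f x (Pi.single i 1)

/-- The Jacobian determinant
`J(f,g,h) = Σ_{σ ∈ S₃} sgn(σ) · ∂_{σ(1)}f · ∂_{σ(2)}g · ∂_{σ(3)}h`. -/
noncomputable def Jdet (f g h : (Fin 3 → ℝ) → ℂ) (x : Fin 3 → ℝ) : ℂ :=
  ∑ σ : Equiv.Perm (Fin 3),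
    ((Equiv.Perm.sign σ : ℤ) : ℂ) * (pd (σ 0) f x * (pd (σ 1) g x * pd (σ 2) h x))

/-- The product in the unitization `A = ℂ ⊕ C_c^∞(ℝ³,ℂ)`:
`(λ,a)(μ,b) = (λμ, λb + μa + ab)`. Elements are modeled as pairs
`(λ, a) : ℂ × ((Fin 3 → ℝ) → ℂ)`. -/
def umul (p q : ℂ × ((Fin 3 → ℝ) → ℂ)) : ℂ × ((Fin 3 → ℝ) → ℂ) :=
  (p.1 * q.1, fun x => p.1 * q.2 x + q.1 * p.2 x + p.2 x * q.2 x)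

/-- The 3-cochain
`φ₃((λ₀,a₀),…,(λ₃,a₃)) = ∫_{ℝ³} (λ₀ + a₀(x)) · J(a₁,a₂,a₃)(x) dx` on the
unitization of `C_c^∞(ℝ³,ℂ)`. -/
noncomputable def phi3 (p₀ p₁ p₂ p₃ : ℂ × ((Fin 3 → ℝ) → ℂ)) : ℂ :=
  ∫ x : Fin 3 → ℝ, (p₀.1 + p₀.2 x) * Jdet p₁.2 p₂.2 p₃.2 x

lemma continuous_pd {f : (Fin 3 → ℝ) → ℂ} (hf : ContDiff ℝ (⊤ : ℕ∞) f) (i : Fin 3) :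
    Continuous (pd i f) :=
  (hf.continuous_fderiv (by simp)).clm_apply continuous_const

lemma continuous_Jdet {f g h : (Fin 3 → ℝ) → ℂ} (hf : ContDiff ℝ (⊤ : ℕ∞) f)
    (hg : ContDiff ℝ (⊤ : ℕ∞) g) (hh : ContDiff ℝ (⊤ : ℕ∞) h) :
    Continuous (Jdet f g h) :=
  continuous_finsetSum _ fun _ _ => continuous_const.mul
    ((continuous_pd hf _).mul ((continuous_pd hg _).mul (continuous_pd hh _)))

lemma hasCompactSupport_Jdet {f : (Fin 3 → ℝ) → ℂ} (g h : (Fin 3 → ℝ) → ℂ)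
    (hf : HasCompactSupport f) : HasCompactSupport (Jdet f g h) := by
  refine hf.mono' fun x hx => ?_
  contrapose! hx
  have hpd (i : Fin 3) : pd i f x = 0 := by
    rw [pd, fderiv_of_notMem_tsupport ℝ hx, zero_apply]
  simp [Jdet, hpd]

lemma integrable_phi3_integrand (p : ℂ × ((Fin 3 → ℝ) → ℂ)) {f g h : (Fin 3 → ℝ) → ℂ}
    (hp : ContDiff ℝ (⊤ : ℕ∞) p.2) (hf : ContDiff ℝ (⊤ : ℕ∞) f)
    (hg : ContDiff ℝ (⊤ : ℕ∞) g) (hh : ContDiff ℝ (⊤ : ℕ∞) h) (hc : HasCompactSupport f) :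
    Integrable fun x => (p.1 + p.2 x) * Jdet f g h x :=
  ((continuous_const.add hp.continuous).mul
    (continuous_Jdet hf hg hh)).integrable_of_hasCompactSupport
      (hasCompactSupport_Jdet g h hc).mul_left

lemma contDiff_umul {p q : ℂ × ((Fin 3 → ℝ) → ℂ)} (hp : ContDiff ℝ (⊤ : ℕ∞) p.2)
    (hq : ContDiff ℝ (⊤ : ℕ∞) q.2) : ContDiff ℝ (⊤ : ℕ∞) (umul p q).2 :=
  ((contDiff_const.mul hq).add (contDiff_const.mul hp)).add (hp.mul hq)

lemma hasCompactSupport_umul {p q : ℂ × ((Fin 3 → ℝ) → ℂ)} (hp : HasCompactSupport p.2)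
    (hq : HasCompactSupport q.2) : HasCompactSupport (umul p q).2 :=
  (hq.mul_left.add hp.mul_left).add hp.mul_right

lemma umul_fst_add_snd (p q : ℂ × ((Fin 3 → ℝ) → ℂ)) (x : Fin 3 → ℝ) :
    (umul p q).1 + (umul p q).2 x = (p.1 + p.2 x) * (q.1 + q.2 x) := by
  simp only [umul]; ring

/-- The Leibniz rule for the product of the unitization. -/
lemma pd_umul {p q : ℂ × ((Fin 3 → ℝ) → ℂ)} (hp : ContDiff ℝ (⊤ : ℕ∞) p.2)
    (hq : ContDiff ℝ (⊤ : ℕ∞) q.2) (i : Fin 3) (x : Fin 3 → ℝ) :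
    pd i (umul p q).2 x = (p.1 + p.2 x) * pd i q.2 x + (q.1 + q.2 x) * pd i p.2 x := by
  have hp' := (hp.differentiable (by simp) x).hasFDerivAt
  have hq' := (hq.differentiable (by simp) x).hasFDerivAt
  have h : HasFDerivAt (umul p q).2 _ x :=
    ((hq'.const_mul p.1).add (hp'.const_mul q.1)).add (hp'.mul hq')
  simp only [pd, h.fderiv, add_apply, smul_apply,
    smul_eq_mul]
  ring

/-- The 3-cochain `φ₃` on the unitization `A = ℂ ⊕ C_c^∞(ℝ³,ℂ)` is a Hochschild
cocycle: `φ₃(ã₀ã₁,ã₂,ã₃,ã₄) − φ₃(ã₀,ã₁ã₂,ã₃,ã₄) + φ₃(ã₀,ã₁,ã₂ã₃,ã₄)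
− φ₃(ã₀,ã₁,ã₂,ã₃ã₄) + φ₃(ã₄ã₀,ã₁,ã₂,ã₃) = 0`, i.e. `bφ₃ = 0`. -/
theorem phi3_hochschild_cocycle (p₀ p₁ p₂ p₃ p₄ : ℂ × ((Fin 3 → ℝ) → ℂ))
    (hs₀ : ContDiff ℝ (⊤ : ℕ∞) p₀.2) (hc₀ : HasCompactSupport p₀.2)
    (hs₁ : ContDiff ℝ (⊤ : ℕ∞) p₁.2) (hc₁ : HasCompactSupport p₁.2)
    (hs₂ : ContDiff ℝ (⊤ : ℕ∞) p₂.2) (hc₂ : HasCompactSupport p₂.2)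
    (hs₃ : ContDiff ℝ (⊤ : ℕ∞) p₃.2) (hc₃ : HasCompactSupport p₃.2)
    (hs₄ : ContDiff ℝ (⊤ : ℕ∞) p₄.2) (hc₄ : HasCompactSupport p₄.2) :
    phi3 (umul p₀ p₁) p₂ p₃ p₄ - phi3 p₀ (umul p₁ p₂) p₃ p₄
      + phi3 p₀ p₁ (umul p₂ p₃) p₄ - phi3 p₀ p₁ p₂ (umul p₃ p₄)
      + phi3 (umul p₄ p₀) p₁ p₂ p₃ = 0 := by
  have i₁ := integrable_phi3_integrand (umul p₀ p₁) (contDiff_umul hs₀ hs₁) hs₂ hs₃ hs₄ hc₂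
  have i₂ := integrable_phi3_integrand p₀ hs₀ (contDiff_umul hs₁ hs₂) hs₃ hs₄
    (hasCompactSupport_umul hc₁ hc₂)
  have i₃ := integrable_phi3_integrand p₀ hs₀ hs₁ (contDiff_umul hs₂ hs₃) hs₄ hc₁
  have i₄ := integrable_phi3_integrand p₀ hs₀ hs₁ hs₂ (contDiff_umul hs₃ hs₄) hc₁
  have i₅ := integrable_phi3_integrand (umul p₄ p₀) (contDiff_umul hs₄ hs₀) hs₁ hs₂ hs₃ hc₁
  unfold phi3
  rw [← integral_sub' i₁ i₂, ← integral_add' (i₁.sub i₂) i₃,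
    ← integral_sub' ((i₁.sub i₂).add i₃) i₄, ← integral_add' (((i₁.sub i₂).add i₃).sub i₄) i₅]
  refine integral_eq_zero_of_ae (.of_forall fun x => ?_)
  simp only [Pi.add_apply, Pi.sub_apply, Pi.zero_apply, umul_fst_add_snd, Jdet, Finset.mul_sum,
    ← Finset.sum_add_distrib, ← Finset.sum_sub_distrib, pd_umul hs₁ hs₂, pd_umul hs₂ hs₃,
    pd_umul hs₃ hs₄]
  exact Finset.sum_eq_zero fun _ _ => by ring
end

section
/- Let a₀, a₁, a₂ : ℝ³ → ℂ be smooth and compactly supported. Then the Stokes identity for the half-space holds: ∫_{{x ∈ ℝ³ : x₃ ≥ 0}} J(a₀, a₁, a₂)(x) dx = − ∫_{ℝ²} a₀(x₁,x₂,0) · ( ∂₁a₁ · ∂₂a₂ − ∂₂a₁ · ∂₁a₂ )(x₁,x₂,0) dx₁ dx₂; that is, the integral of the exact form da₀∧da₁∧da₂ over the half-space equals the integral of a₀ da₁∧da₂ over its boundary plane x₃ = 0 with the induced orientation. -/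
open MeasureTheory

/-- Fubini along the `i`-th coordinate. -/
theorem integral_eq_integral_insertNth {E : Type*} [NormedAddCommGroup E] [NormedSpace ℝ E]
    {n : ℕ} (i : Fin (n + 1)) {g : (Fin (n + 1) → ℝ) → E} (hg : Integrable g) :
    ∫ x, g x = ∫ y : Fin n → ℝ, ∫ t : ℝ, g (i.insertNth t y) := by
  have hmp := (volume_preserving_piFinSuccAbove (fun _ : Fin (n + 1) => ℝ) i).symm
  rw [← hmp.integral_comp', Measure.volume_eq_prod, integral_prod_symm]
  · rfl
  · exact (hmp.integrable_comp_emb (MeasurableEquiv.measurableEmbedding _)).2 hg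

theorem insertNth_eq_update {n : ℕ} (i : Fin (n + 1)) (y : Fin n → ℝ) :
    (fun t : ℝ => (i.insertNth t y : Fin (n + 1) → ℝ)) =
      Function.update (i.insertNth (0 : ℝ) y : Fin (n + 1) → ℝ) i :=
  funext fun t => (Fin.update_insertNth (α := fun _ => ℝ) i 0 t y).symm

theorem hasDerivAt_insertNth {n : ℕ} (i : Fin (n + 1)) (y : Fin n → ℝ) (t : ℝ) :
    HasDerivAt (fun t : ℝ => (i.insertNth t y : Fin (n + 1) → ℝ)) (Pi.single i 1) t :=
  insertNth_eq_update i y ▸ hasDerivAt_update _ i t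

theorem isClosedEmbedding_insertNth {n : ℕ} (i : Fin (n + 1)) (y : Fin n → ℝ) :
    Topology.IsClosedEmbedding (fun t : ℝ => (i.insertNth t y : Fin (n + 1) → ℝ)) :=
  Function.LeftInverse.isClosedEmbedding (f := fun x : Fin (n + 1) → ℝ => x i)
    (fun t => by simp) (continuous_apply i)
    (continuous_iff_continuousAt.2 fun t => (hasDerivAt_insertNth i y t).continuousAt)

theorem contDiff_insertNth {n : ℕ} (i : Fin (n + 1)) (y : Fin n → ℝ) {k : WithTop ℕ∞} :
    ContDiff ℝ k (fun t : ℝ => (i.insertNth t y : Fin (n + 1) → ℝ)) :=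
  insertNth_eq_update i y ▸ contDiff_update (𝕜 := ℝ) k _ i

theorem contDiff_pd {f : (Fin 3 → ℝ) → ℂ} {m k : WithTop ℕ∞} (hf : ContDiff ℝ k f)
    (hmk : m + 1 ≤ k) (i : Fin 3) : ContDiff ℝ m (pd i f) :=
  (hf.fderiv_right hmk).clm_apply contDiff_const

theorem integrable_pd {F : (Fin 3 → ℝ) → ℂ} (hF : ContDiff ℝ 1 F) (hc : HasCompactSupport F)
    (i : Fin 3) : Integrable (pd i F) :=
  (contDiff_pd hF (m := 0) (by simp) i).continuous.integrable_of_hasCompactSupport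
    (hc.fderiv_apply ℝ _)

theorem hasDerivAt_comp_insertNth {F : (Fin 3 → ℝ) → ℂ} (hF : ContDiff ℝ 1 F) (i : Fin 3)
    (y : Fin 2 → ℝ) (t : ℝ) :
    HasDerivAt (fun t : ℝ => F (i.insertNth t y)) (pd i F (i.insertNth t y)) t :=
  (hF.differentiable one_ne_zero _).hasFDerivAt.comp_hasDerivAt t (hasDerivAt_insertNth i y t)

theorem measurableSet_halfSpace : MeasurableSet {x : Fin 3 → ℝ | 0 ≤ x 2} :=
  measurableSet_le measurable_const (measurable_pi_apply 2)

/-- A normal derivative integrates over the half-space to a boundary term. -/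
theorem setIntegral_halfSpace_pd_normal {F : (Fin 3 → ℝ) → ℂ} (hF : ContDiff ℝ 1 F)
    (hc : HasCompactSupport F) :
    ∫ x in {x : Fin 3 → ℝ | 0 ≤ x 2}, pd 2 F x = - ∫ y : Fin 2 → ℝ, F ![y 0, y 1, 0] := by
  rw [← integral_indicator measurableSet_halfSpace, integral_eq_integral_insertNth 2
    ((integrable_pd hF hc 2).indicator measurableSet_halfSpace), ← integral_neg]
  refine integral_congr_ae (.of_forall fun y => ?_)
  have hslice := HasCompactSupport.integral_Ioi_deriv_eq
    (f := fun t : ℝ => F ((2 : Fin 3).insertNth t y)) (hF.comp (contDiff_insertNth 2 y))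
    (hc.comp_isClosedEmbedding (isClosedEmbedding_insertNth 2 y)) 0
  have hpt : ((2 : Fin 3).insertNth (0 : ℝ) y : Fin 3 → ℝ) = ![y 0, y 1, 0] := by
    ext j; fin_cases j <;> rfl
  simp only [(hasDerivAt_comp_insertNth hF 2 y _).deriv, hpt] at hslice
  beta_reduce
  rw [← hslice, ← integral_Ici_eq_integral_Ioi, ← integral_indicator measurableSet_Ici]
  refine integral_congr_ae (.of_forall fun t => ?_)
  simp [Set.indicator_apply]

/-- A tangential derivative integrates to zero over the half-space. -/
theorem setIntegral_halfSpace_pd_tangential {F : (Fin 3 → ℝ) → ℂ} (hF : ContDiff ℝ 1 F)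
    (hc : HasCompactSupport F) {i : Fin 3} (hi : i ≠ 2) :
    ∫ x in {x : Fin 3 → ℝ | 0 ≤ x 2}, pd i F x = 0 := by
  rw [← integral_indicator measurableSet_halfSpace, integral_eq_integral_insertNth i
    ((integrable_pd hF hc i).indicator measurableSet_halfSpace)]
  refine integral_eq_zero_of_ae (.of_forall fun y => ?_)
  obtain ⟨j, hj⟩ := Fin.exists_succAbove_eq hi.symm
  have hemb := isClosedEmbedding_insertNth i y
  have hslice : ∫ t : ℝ, pd i F (i.insertNth t y) = 0 :=
    integral_eq_zero_of_hasDerivAt_of_integrable (hasDerivAt_comp_insertNth hF i y)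
      (((contDiff_pd hF (m := 0) (by simp) i).continuous.comp
        hemb.continuous).integrable_of_hasCompactSupport
        ((hc.fderiv_apply ℝ (Pi.single i 1)).comp_isClosedEmbedding hemb))
      ((hF.continuous.comp hemb.continuous).integrable_of_hasCompactSupport
        (hc.comp_isClosedEmbedding hemb))
  have hmem (t : ℝ) : (i.insertNth t y : Fin 3 → ℝ) 2 = y j := by
    rw [← hj, Fin.insertNth_apply_succAbove]
  by_cases h : 0 ≤ y j <;> simp [hmem, h, hslice]

theorem pd_mul {f g : (Fin 3 → ℝ) → ℂ} {x : Fin 3 → ℝ} (hf : DifferentiableAt ℝ f x)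
    (hg : DifferentiableAt ℝ g x) (i : Fin 3) :
    pd i (fun x => f x * g x) x = f x * pd i g x + pd i f x * g x := by
  simp [pd, fderiv_fun_mul hf hg, mul_comm]

theorem pd_sub {f g : (Fin 3 → ℝ) → ℂ} {x : Fin 3 → ℝ} (hf : DifferentiableAt ℝ f x)
    (hg : DifferentiableAt ℝ g x) (i : Fin 3) :
    pd i (fun x => f x - g x) x = pd i f x - pd i g x := by
  simp [pd, fderiv_fun_sub hf hg]

theorem pd_comm {f : (Fin 3 → ℝ) → ℂ} (hf : ContDiff ℝ 2 f) (i j : Fin 3) (x : Fin 3 → ℝ) :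
    pd i (pd j f) x = pd j (pd i f) x := by
  have hd : DifferentiableAt ℝ (fderiv ℝ f) x :=
    (hf.fderiv_right (m := 1) (by norm_num)).differentiable one_ne_zero x
  have hpd (i j : Fin 3) :
      pd i (pd j f) x = fderiv ℝ (fderiv ℝ f) x (Pi.single i 1) (Pi.single j 1) := by
    change fderiv ℝ (fun x => fderiv ℝ f x (Pi.single j 1)) x (Pi.single i 1) = _
    simp [fderiv_clm_apply hd (differentiableAt_const _)]
  rw [hpd, hpd]
  exact (hf.contDiffAt.isSymmSndFDerivAt (by simp)) _ _

/-- The coefficient of `f dg ∧ dh` along `dxᵢ ∧ dxⱼ`. -/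
noncomputable def wedgeCoeff (f g h : (Fin 3 → ℝ) → ℂ) (i j : Fin 3) (x : Fin 3 → ℝ) : ℂ :=
  f x * (pd i g x * pd j h x - pd j g x * pd i h x)

theorem contDiff_wedgeCoeff {f g h : (Fin 3 → ℝ) → ℂ} (hf : ContDiff ℝ 1 f)
    (hg : ContDiff ℝ 2 g) (hh : ContDiff ℝ 2 h) (i j : Fin 3) :
    ContDiff ℝ 1 (wedgeCoeff f g h i j) := by
  have hg' (i : Fin 3) : ContDiff ℝ 1 (pd i g) := contDiff_pd hg (by norm_num) i
  have hh' (i : Fin 3) : ContDiff ℝ 1 (pd i h) := contDiff_pd hh (by norm_num) i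
  exact hf.mul (((hg' i).mul (hh' j)).sub ((hg' j).mul (hh' i)))

theorem pd_wedgeCoeff {f g h : (Fin 3 → ℝ) → ℂ} (hf : ContDiff ℝ 1 f)
    (hg : ContDiff ℝ 2 g) (hh : ContDiff ℝ 2 h) (i j k : Fin 3) (x : Fin 3 → ℝ) :
    pd k (wedgeCoeff f g h i j) x =
      f x * ((pd i g x * pd k (pd j h) x + pd k (pd i g) x * pd j h x)
        - (pd j g x * pd k (pd i h) x + pd k (pd j g) x * pd i h x))
      + pd k f x * (pd i g x * pd j h x - pd j g x * pd i h x) := by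
  have hf' : DifferentiableAt ℝ f x := hf.differentiable one_ne_zero x
  have hg' (i : Fin 3) : DifferentiableAt ℝ (pd i g) x :=
    (contDiff_pd hg (m := 1) (by norm_num) i).differentiable one_ne_zero x
  have hh' (i : Fin 3) : DifferentiableAt ℝ (pd i h) x :=
    (contDiff_pd hh (m := 1) (by norm_num) i).differentiable one_ne_zero x
  have h₁ := (hg' i).fun_mul (hh' j)
  have h₂ := (hg' j).fun_mul (hh' i)
  unfold wedgeCoeff
  rw [pd_mul hf' (h₁.fun_sub h₂), pd_sub h₁ h₂, pd_mul (hg' i) (hh' j), pd_mul (hg' j) (hh' i)]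

theorem Jdet_eq (f g h : (Fin 3 → ℝ) → ℂ) (x : Fin 3 → ℝ) :
    Jdet f g h x =
      pd 0 f x * (pd 1 g x * pd 2 h x - pd 2 g x * pd 1 h x)
      + pd 1 f x * (pd 2 g x * pd 0 h x - pd 0 g x * pd 2 h x)
      + pd 2 f x * (pd 0 g x * pd 1 h x - pd 1 g x * pd 0 h x) := by
  have hdet := Matrix.det_apply' (Matrix.of fun i j : Fin 3 => pd i (![f, g, h] j) x)
  rw [Matrix.det_fin_three] at hdet
  simp only [Fin.prod_univ_three, Matrix.of_apply, Matrix.cons_val] at hdet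
  simp only [Jdet, ← mul_assoc] at hdet ⊢
  rw [← hdet]
  ring

/-- `df ∧ dg ∧ dh` is the exterior derivative of `f dg ∧ dh`. -/
theorem Jdet_eq_sum_pd_wedgeCoeff {f g h : (Fin 3 → ℝ) → ℂ} (hf : ContDiff ℝ 1 f)
    (hg : ContDiff ℝ 2 g) (hh : ContDiff ℝ 2 h) (x : Fin 3 → ℝ) :
    Jdet f g h x = pd 0 (wedgeCoeff f g h 1 2) x + pd 1 (wedgeCoeff f g h 2 0) x
      + pd 2 (wedgeCoeff f g h 0 1) x := by
  simp only [Jdet_eq, pd_wedgeCoeff hf hg hh]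
  rw [pd_comm hg 1 0, pd_comm hg 2 0, pd_comm hg 2 1, pd_comm hh 1 0, pd_comm hh 2 0,
    pd_comm hh 2 1]
  ring

/-- Stokes identity for the half-space: for smooth compactly supported
`a₀, a₁, a₂ : ℝ³ → ℂ`, the integral of the exact form `da₀ ∧ da₁ ∧ da₂` over
`{x₃ ≥ 0}` equals minus the integral over the boundary plane `x₃ = 0` of
`a₀ · (∂₁a₁·∂₂a₂ − ∂₂a₁·∂₁a₂)`. -/
theorem half_space_stokes (a₀ a₁ a₂ : (Fin 3 → ℝ) → ℂ)
    (hs₀ : ContDiff ℝ (⊤ : ℕ∞) a₀) (hc₀ : HasCompactSupport a₀)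
    (hs₁ : ContDiff ℝ (⊤ : ℕ∞) a₁) (hc₁ : HasCompactSupport a₁)
    (hs₂ : ContDiff ℝ (⊤ : ℕ∞) a₂) (hc₂ : HasCompactSupport a₂) :
    ∫ x in {x : Fin 3 → ℝ | 0 ≤ x 2}, Jdet a₀ a₁ a₂ x
      = - ∫ y : Fin 2 → ℝ,
          a₀ ![y 0, y 1, 0] *
            (pd 0 a₁ ![y 0, y 1, 0] * pd 1 a₂ ![y 0, y 1, 0]
              - pd 1 a₁ ![y 0, y 1, 0] * pd 0 a₂ ![y 0, y 1, 0]) := by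
  have h₀ : ContDiff ℝ 1 a₀ := hs₀.of_le (mod_cast le_top)
  have h₁ : ContDiff ℝ 2 a₁ := contDiff_infty.1 hs₁ 2
  have h₂ : ContDiff ℝ 2 a₂ := contDiff_infty.1 hs₂ 2
  have hd (i j : Fin 3) := contDiff_wedgeCoeff h₀ h₁ h₂ i j
  have hc (i j : Fin 3) : HasCompactSupport (wedgeCoeff a₀ a₁ a₂ i j) := hc₀.mul_right
  have hi (i j k : Fin 3) :=
    (integrable_pd (hd i j) (hc i j) k).integrableOn (s := {x : Fin 3 → ℝ | 0 ≤ x 2})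
  simp only [Jdet_eq_sum_pd_wedgeCoeff h₀ h₁ h₂]
  rw [integral_add (by exact (hi 1 2 0).add (hi 2 0 1)) (hi 0 1 2), integral_add (hi 1 2 0) (hi 2 0 1),
    setIntegral_halfSpace_pd_tangential (hd 1 2) (hc 1 2) (by decide),
    setIntegral_halfSpace_pd_tangential (hd 2 0) (hc 2 0) (by decide),
    setIntegral_halfSpace_pd_normal (hd 0 1) (hc 0 1), zero_add, zero_add]
  rfl
end

section
/- Let a₀, a₁ : ℝ² \ {0} → ℂ be continuously differentiable and positively homogeneous of degree 0, i.e. a_i(t·v) = a_i(v) for all t > 0 and v ≠ 0. Then the functions t ↦ a₀(1,t)·(d/dt)[a₁(1,t)] and t ↦ a₀(−1,t)·(d/dt)[a₁(−1,t)] are integrable on ℝ, and the line integral of a₀ da₁ over the positively oriented unit circle decomposes as ∫₀^{2π} a₀(cos θ, sin θ) · (d/dθ)[ a₁(cos θ, sin θ) ] dθ = ∫_ℝ a₀(1,t) · (d/dt)[ a₁(1,t) ] dt − ∫_ℝ a₀(−1,t) · (d/dt)[ a₁(−1,t) ] dt. -/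
open MeasureTheory Real

/-- The integrand `a₀ da₁` along the unit circle is continuous when `a₀, a₁` are `C¹` away from
the origin. -/
theorem continuous_circle_integrand {a₀ a₁ : ℝ × ℝ → ℂ}
    (h₀ : ContDiffOn ℝ 1 a₀ {v : ℝ × ℝ | v ≠ 0})
    (h₁ : ContDiffOn ℝ 1 a₁ {v : ℝ × ℝ | v ≠ 0}) :
    Continuous fun θ : ℝ => a₀ (Real.cos θ, Real.sin θ) *
      deriv (fun t : ℝ => a₁ (Real.cos t, Real.sin t)) θ := by
  have hne : ∀ θ : ℝ, (Real.cos θ, Real.sin θ) ∈ {v : ℝ × ℝ | v ≠ 0} := by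
    intro θ h
    obtain ⟨hc, hs⟩ := Prod.mk.inj h
    simpa [hc, hs] using Real.sin_sq_add_cos_sq θ
  have hcirc : ContDiff ℝ 1 fun θ : ℝ => (Real.cos θ, Real.sin θ) :=
    Real.contDiff_cos.prodMk Real.contDiff_sin
  have h₁' : ContDiff ℝ 1 fun t : ℝ => a₁ (Real.cos t, Real.sin t) :=
    h₁.comp_contDiff hcirc hne
  exact (h₀.comp_contDiff hcirc hne).continuous.mul (h₁'.continuous_deriv le_rfl)

/-- Central projection from the right open half-circle to the line `{1} × ℝ`. -/
theorem integrable_line_and_integral_half_circle {a₀ a₁ : ℝ × ℝ → ℂ}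
    (h₀ : ContDiffOn ℝ 1 a₀ {v : ℝ × ℝ | v ≠ 0})
    (h₁ : ContDiffOn ℝ 1 a₁ {v : ℝ × ℝ | v ≠ 0})
    (hom₀ : ∀ t : ℝ, 0 < t → ∀ v : ℝ × ℝ, v ≠ 0 → a₀ (t • v) = a₀ v)
    (hom₁ : ∀ t : ℝ, 0 < t → ∀ v : ℝ × ℝ, v ≠ 0 → a₁ (t • v) = a₁ v) :
    (Integrable fun t : ℝ => a₀ (1, t) * deriv (fun s : ℝ => a₁ (1, s)) t) ∧
    ∫ θ in (-(π / 2))..(π / 2), a₀ (Real.cos θ, Real.sin θ) *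
        deriv (fun t : ℝ => a₁ (Real.cos t, Real.sin t)) θ
      = ∫ t : ℝ, a₀ (1, t) * deriv (fun s : ℝ => a₁ (1, s)) t := by
  have key : ∀ a : ℝ × ℝ → ℂ,
      (∀ t : ℝ, 0 < t → ∀ v : ℝ × ℝ, v ≠ 0 → a (t • v) = a v) →
      ∀ θ ∈ Set.Ioo (-(π / 2)) (π / 2),
        a (Real.cos θ, Real.sin θ) = a (1, Real.tan θ) := by
    intro a ha θ hθ
    have hc := Real.cos_pos_of_mem_Ioo hθ
    rw [← ha _ hc (1, Real.tan θ) (by simp), Prod.smul_mk, smul_eq_mul, smul_eq_mul, mul_one,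
      mul_comm, Real.tan_mul_cos hc.ne']
  have hdiff : Differentiable ℝ fun s : ℝ => a₁ (1, s) :=
    (h₁.comp_contDiff (contDiff_const.prodMk contDiff_id) (by simp)).differentiable one_ne_zero
  have hderiv : ∀ θ ∈ Set.Ioo (-(π / 2)) (π / 2),
      deriv (fun t : ℝ => a₁ (Real.cos t, Real.sin t)) θ
        = (1 / Real.cos θ ^ 2) • deriv (fun s : ℝ => a₁ (1, s)) (Real.tan θ) := by
    intro θ hθ
    have hev : (fun t : ℝ => a₁ (Real.cos t, Real.sin t)) =ᶠ[nhds θ]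
        (fun s : ℝ => a₁ (1, s)) ∘ Real.tan := by
      filter_upwards [isOpen_Ioo.mem_nhds hθ] with t ht using key a₁ hom₁ t ht
    rw [hev.deriv_eq]
    exact ((hdiff _).hasDerivAt.scomp θ
      (Real.hasDerivAt_tan (Real.cos_pos_of_mem_Ioo hθ).ne')).deriv
  have htan : ∀ θ ∈ Set.Ioo (-(π / 2)) (π / 2),
      HasDerivWithinAt Real.tan (1 / Real.cos θ ^ 2) (Set.Ioo (-(π / 2)) (π / 2)) θ :=
    fun θ hθ => (Real.hasDerivAt_tan (Real.cos_pos_of_mem_Ioo hθ).ne').hasDerivWithinAt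
  have heq : Set.EqOn
      (fun θ : ℝ => a₀ (Real.cos θ, Real.sin θ) *
        deriv (fun t : ℝ => a₁ (Real.cos t, Real.sin t)) θ)
      (fun θ : ℝ => |1 / Real.cos θ ^ 2| •
        (a₀ (1, Real.tan θ) * deriv (fun s : ℝ => a₁ (1, s)) (Real.tan θ)))
      (Set.Ioo (-(π / 2)) (π / 2)) := by
    intro θ hθ
    simp only [hderiv θ hθ, key a₀ hom₀ θ hθ, abs_of_nonneg (show 0 ≤ 1 / Real.cos θ ^ 2 by
      positivity), mul_smul_comm]
  have hintegrable : IntegrableOn (fun θ : ℝ => a₀ (Real.cos θ, Real.sin θ) *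
      deriv (fun t : ℝ => a₁ (Real.cos t, Real.sin t)) θ) (Set.Ioo (-(π / 2)) (π / 2)) :=
    ((continuous_circle_integrand h₀ h₁).integrableOn_Icc).mono_set Set.Ioo_subset_Icc_self
  constructor
  · rw [← integrableOn_univ, ← Real.image_tan_Ioo,
      integrableOn_image_iff_integrableOn_abs_deriv_smul measurableSet_Ioo htan
        Real.injOn_tan]
    exact hintegrable.congr_fun heq measurableSet_Ioo
  · rw [intervalIntegral.integral_of_le (by linarith [Real.pi_pos]),
      integral_Ioc_eq_integral_Ioo, setIntegral_congr_fun measurableSet_Ioo heq,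
      ← integral_image_eq_integral_abs_deriv_smul measurableSet_Ioo htan Real.injOn_tan
        (fun t : ℝ => a₀ (1, t) * deriv (fun s : ℝ => a₁ (1, s)) t),
      Real.image_tan_Ioo, setIntegral_univ]

/-- Change of variables on the unit circle: for `a₀, a₁ : ℝ² \ {0} → ℂ` continuously
differentiable and positively homogeneous of degree `0`, the functions
`t ↦ a₀(±1,t)·(d/dt)[a₁(±1,t)]` are integrable on `ℝ` and the line integral of
`a₀ da₁` over the positively oriented unit circle decomposes as
`∫₀^{2π} a₀(cos θ, sin θ)·(d/dθ)[a₁(cos θ, sin θ)] dθ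
  = ∫_ℝ a₀(1,t)·(d/dt)[a₁(1,t)] dt − ∫_ℝ a₀(−1,t)·(d/dt)[a₁(−1,t)] dt`. -/
theorem circle_integral_eq_lines (a₀ a₁ : ℝ × ℝ → ℂ)
    (h₀ : ContDiffOn ℝ 1 a₀ {v : ℝ × ℝ | v ≠ 0})
    (h₁ : ContDiffOn ℝ 1 a₁ {v : ℝ × ℝ | v ≠ 0})
    (hom₀ : ∀ t : ℝ, 0 < t → ∀ v : ℝ × ℝ, v ≠ 0 → a₀ (t • v) = a₀ v)
    (hom₁ : ∀ t : ℝ, 0 < t → ∀ v : ℝ × ℝ, v ≠ 0 → a₁ (t • v) = a₁ v) :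
    (Integrable fun t : ℝ => a₀ (1, t) * deriv (fun s : ℝ => a₁ (1, s)) t) ∧
    (Integrable fun t : ℝ => a₀ (-1, t) * deriv (fun s : ℝ => a₁ (-1, s)) t) ∧
    ∫ θ in (0 : ℝ)..(2 * π),
        a₀ (Real.cos θ, Real.sin θ) *
          deriv (fun t : ℝ => a₁ (Real.cos t, Real.sin t)) θ
      = (∫ t : ℝ, a₀ (1, t) * deriv (fun s : ℝ => a₁ (1, s)) t)
        - ∫ t : ℝ, a₀ (-1, t) * deriv (fun s : ℝ => a₁ (-1, s)) t := by
  have hneg : ContDiff ℝ 1 fun v : ℝ × ℝ => -v := contDiff_neg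
  obtain ⟨hintegrable, hright⟩ := integrable_line_and_integral_half_circle h₀ h₁ hom₀ hom₁
  obtain ⟨hintegrable', hleft⟩ := integrable_line_and_integral_half_circle
    (a₀ := fun v => a₀ (-v)) (a₁ := fun v => a₁ (-v))
    (h₀.comp hneg.contDiffOn fun v hv => neg_ne_zero.mpr hv)
    (h₁.comp hneg.contDiffOn fun v hv => neg_ne_zero.mpr hv)
    (fun t ht v hv => by rw [← smul_neg, hom₀ t ht _ (neg_ne_zero.mpr hv)])
    (fun t ht v hv => by rw [← smul_neg, hom₁ t ht _ (neg_ne_zero.mpr hv)])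
  have hline : (fun t : ℝ => a₀ (-(1, t)) * deriv (fun s : ℝ => a₁ (-(1, s))) t)
      = fun t : ℝ => -(a₀ (-1, -t) * deriv (fun s : ℝ => a₁ (-1, s)) (-t)) := by
    funext t
    simp only [Prod.neg_mk]
    rw [deriv_comp_neg (fun s : ℝ => a₁ (-1, s)), mul_neg]
  rw [hline] at hintegrable' hleft
  refine ⟨hintegrable, ?_, ?_⟩
  · simpa using hintegrable'.neg.comp_neg
  rw [integral_neg,
    integral_neg_eq_self (fun t : ℝ => a₀ (-1, t) * deriv (fun s : ℝ => a₁ (-1, s)) t) volume]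
    at hleft
  set g : ℝ → ℂ := fun θ => a₀ (Real.cos θ, Real.sin θ) *
    deriv (fun t : ℝ => a₁ (Real.cos t, Real.sin t)) θ with hg
  have hcont : Continuous g := continuous_circle_integrand h₀ h₁
  have hper : Function.Periodic g (2 * π) := by
    intro θ
    simp only [hg]
    rw [← deriv_comp_add_const]
    simp only [Real.cos_add_two_pi, Real.sin_add_two_pi]
  have hshift : (fun θ : ℝ => a₀ (-(Real.cos θ, Real.sin θ)) *
      deriv (fun t : ℝ => a₁ (-(Real.cos t, Real.sin t))) θ) = fun θ => g (θ + π) := by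
    funext θ
    simp only [hg]
    rw [← deriv_comp_add_const]
    simp only [Real.cos_add_pi, Real.sin_add_pi, Prod.neg_mk]
  rw [hshift, intervalIntegral.integral_comp_add_right] at hleft
  have hturn := hper.intervalIntegral_add_eq 0 (-(π / 2))
  rw [zero_add] at hturn
  rw [hturn, ← intervalIntegral.integral_add_adjacent_intervals (b := π / 2)
    (hcont.intervalIntegrable _ _) (hcont.intervalIntegrable _ _), hright, sub_eq_add_neg,
    ← hleft]
  congr 2 <;> ring
end
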